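/- arXiv:1609.01133 — 2 statements merged into one kernel-verified Lean document; each statement's English description precedes it below -/
import Mathlib

section
/- For every positive integer k, the numerical semigroup generated by S = {6k+1, 6k+3, 6k+5} is a 3-permutation numerical semigroup. -/
/-- The increasing enumeration of the positive elements of a submonoid `G` of `ℕ`
(0-indexed: `posSeq G 0` is the smallest positive element `g₁` of `G`). -/
noncomputable def posSeq (G : AddSubmonoid ℕ) : ℕ → ℕ :=
  Nat.nth (fun x => x ∈ G ∧ 0 < x)

/-- `G` is an `n`-permutation numerical semigroup: `G` is a cofinite submonoid of `ℕ`,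
it is generated by its `n` smallest positive elements `g₁ < ⋯ < gₙ`, and for every
`k ≥ 0` the tuple `(g_{kn+1} mod n, …, g_{kn+n} mod n)` contains exactly one
representative of each residue class of `ℤ/nℤ`. -/
def IsPermutationSemigroup (n : ℕ) (G : AddSubmonoid ℕ) : Prop :=
  ((G : Set ℕ)ᶜ).Finite ∧
  G = AddSubmonoid.closure (posSeq G '' Set.Iio n) ∧
  ∀ k : ℕ, Function.Bijective (fun j : Fin n => ((posSeq G (k * n + j.val) : ℕ) : ZMod n))

open Classical in
/-- Number of `y < x` in the semigroup with `0 < y` and residue `i` mod 3. -/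
noncomputable def cntRes (P : ℕ → Prop) (i x : ℕ) : ℕ :=
  Nat.count (fun y => P y ∧ y % 3 = i) x

lemma mem_closure_family (k x : ℕ) :
    x ∈ AddSubmonoid.closure ({6 * k + 1, 6 * k + 3, 6 * k + 5} : Set ℕ) ↔
      ∃ m j, j ≤ 2 * m ∧ x = m * (6 * k + 1) + 2 * j := by
  constructor
  · intro h
    induction h using AddSubmonoid.closure_induction with
    | mem y hy =>
      simp only [Set.mem_insert_iff, Set.mem_singleton_iff] at hy
      rcases hy with rfl | rfl | rfl
      · exact ⟨1, 0, by omega, by omega⟩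
      · exact ⟨1, 1, by omega, by omega⟩
      · exact ⟨1, 2, by omega, by omega⟩
    | zero => exact ⟨0, 0, by omega, by omega⟩
    | add y z _ _ hy hz =>
      obtain ⟨m, j, h1, h2⟩ := hy
      obtain ⟨m', j', h1', h2'⟩ := hz
      exact ⟨m + m', j + j', by omega, by rw [h2, h2']; ring⟩
  · rintro ⟨m, j, hj, rfl⟩
    induction m generalizing j with
    | zero =>
      obtain rfl : j = 0 := by omega
      simp
    | succ m ih =>
      have hg : ∀ y ∈ ({6 * k + 1, 6 * k + 3, 6 * k + 5} : Set ℕ),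
          y ∈ AddSubmonoid.closure ({6 * k + 1, 6 * k + 3, 6 * k + 5} : Set ℕ) :=
        fun y hy => AddSubmonoid.subset_closure hy
      by_cases h0 : j ≤ 2 * m
      · have := add_mem (ih j h0) (hg (6 * k + 1) (by simp))
        convert this using 1; ring
      · by_cases h1 : j = 2 * m + 1
        · have := add_mem (ih (2 * m) le_rfl) (hg (6 * k + 3) (by simp))
          convert this using 1; subst h1; ring
        · have h2 : j = 2 * m + 2 := by omega
          have := add_mem (ih (2 * m) le_rfl) (hg (6 * k + 5) (by simp))
          convert this using 1; subst h2; ring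

lemma mem_family_iff (k q r : ℕ) (hr : r ≤ 6 * k) :
    q * (6 * k + 1) + r ∈ AddSubmonoid.closure ({6 * k + 1, 6 * k + 3, 6 * k + 5} : Set ℕ) ↔
      (r % 2 = 0 ∧ r ≤ 4 * q) ∨ (r % 2 = 1 ∧ r + 6 * k + 5 ≤ 4 * q) := by
  rw [mem_closure_family]
  constructor
  · rintro ⟨m, j, hj, h⟩
    have hmq : m ≤ q := by
      by_contra hc
      have : (q + 1) * (6 * k + 1) ≤ m * (6 * k + 1) := Nat.mul_le_mul_right _ (by omega)
      rw [add_mul] at this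
      omega
    obtain ⟨d, rfl⟩ := Nat.exists_eq_add_of_le hmq
    have h' : d * (6 * k + 1) + r = 2 * j := by rw [add_mul] at h; omega
    rcases Nat.even_or_odd r with hre | hro
    · left
      exact ⟨Nat.even_iff.mp hre, by omega⟩
    · right
      have hro' := Nat.odd_iff.mp hro
      refine ⟨hro', ?_⟩
      rcases Nat.eq_zero_or_pos d with rfl | hd
      · omega
      · have : 1 * (6 * k + 1) ≤ d * (6 * k + 1) := Nat.mul_le_mul_right _ hd
        omega
  · rintro (⟨h1, h2⟩ | ⟨h1, h2⟩)
    · exact ⟨q, r / 2, by omega, by omega⟩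
    · obtain ⟨q, rfl⟩ : ∃ q', q = q' + 1 := ⟨q - 1, by omega⟩
      exact ⟨q, (r + 6 * k + 1) / 2, by omega, by rw [add_mul]; omega⟩

/-- State of an "even only" stretch. -/
def stE (q h : ℕ) : ℤ × ℤ :=
  if q % 3 = 0 then (if h % 3 = 0 then (-1, -1) else if h % 3 = 1 then (0, 0) else (0, -1))
  else if q % 3 = 1 then (if h % 3 = 0 then (0, 0) else if h % 3 = 1 then (-1, 0) else (0, 1))
  else (if h % 3 = 0 then (0, 0) else if h % 3 = 1 then (0, -1) else (-1, -1))

/-- State of a "full" stretch. -/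
def stF (q r : ℕ) : ℤ × ℤ :=
  if q % 3 = 0 then (if r % 3 = 0 then (0, -1) else if r % 3 = 1 then (1, 0) else (0, 0))
  else if q % 3 = 1 then (if r % 3 = 0 then (0, 0) else if r % 3 = 1 then (-1, 0) else (-1, -1))
  else (if r % 3 = 0 then (-1, 0) else if r % 3 = 1 then (-1, -1) else (0, 0))

/-- State beyond the conductor. -/
def stL (y : ℕ) : ℤ × ℤ :=
  if y % 3 = 0 then (-1, -1) else if y % 3 = 1 then (0, 0) else (-1, 0)

def st (k q r : ℕ) : ℤ × ℤ :=
  if 3 * k + 2 ≤ q then stL (q + r)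
  else if r + 6 * k + 3 ≤ 4 * q then stF q r
  else stE q (min ((r + 1) / 2) (2 * q + 1))

/-- Increment by an element of residue `y`. -/
def inc (y : ℕ) : ℤ × ℤ :=
  if y % 3 = 0 then (1, 1) else if y % 3 = 1 then (-1, 0) else (0, -1)

lemma stE_step (q h : ℕ) : stE q (h + 1) = stE q h + inc (q + 2 * h) := by
  have hq : q % 3 = 0 ∨ q % 3 = 1 ∨ q % 3 = 2 := by omega
  have hh : h % 3 = 0 ∨ h % 3 = 1 ∨ h % 3 = 2 := by omega
  rcases hq with hq | hq | hq <;> rcases hh with hh | hh | hh <;>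
    simp [stE, inc, Nat.add_mod, Nat.mul_mod, hq, hh]

lemma stF_step (q r : ℕ) : stF q (r + 1) = stF q r + inc (q + r) := by
  have hq : q % 3 = 0 ∨ q % 3 = 1 ∨ q % 3 = 2 := by omega
  have hh : r % 3 = 0 ∨ r % 3 = 1 ∨ r % 3 = 2 := by omega
  rcases hq with hq | hq | hq <;> rcases hh with hh | hh | hh <;>
    simp [stF, inc, Nat.add_mod, hq, hh]

lemma stL_step (y : ℕ) : stL (y + 1) = stL y + inc y := by
  have hq : y % 3 = 0 ∨ y % 3 = 1 ∨ y % 3 = 2 := by omega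
  rcases hq with hq | hq | hq <;>
    simp [stL, inc, Nat.add_mod, hq]

lemma stF_eq_stE (k q r h : ℕ) (h1 : r + 6 * k + 3 = 4 * q) (h2 : r + 1 = 2 * h) :
    stE q h = stF q r := by
  have hq : q % 3 = 0 ∨ q % 3 = 1 ∨ q % 3 = 2 := by omega
  rcases hq with hq | hq | hq
  · have a : r % 3 = 0 := by omega
    have b : h % 3 = 2 := by omega
    simp [stE, stF, hq, a, b]
  · have a : r % 3 = 1 := by omega
    have b : h % 3 = 1 := by omega
    simp [stE, stF, hq, a, b]
  · have a : r % 3 = 2 := by omega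
    have b : h % 3 = 0 := by omega
    simp [stE, stF, hq, a, b]

/-- Membership of `q * (6k+1) + r`. -/
abbrev memB (k q r : ℕ) : Prop :=
  (r % 2 = 0 ∧ r ≤ 4 * q) ∨ (r % 2 = 1 ∧ r + 6 * k + 5 ≤ 4 * q)

lemma st_step (k q r : ℕ) (hr : r ≤ 6 * k) :
    st k q (r + 1) = st k q r + if memB k q r then inc (q + r) else 0 := by
  unfold st
  by_cases hL : 3 * k + 2 ≤ q
  · have hm : memB k q r := by unfold memB; omega
    rw [if_pos hL, if_pos hL, if_pos hm, ← add_assoc, stL_step]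
  rw [if_neg hL, if_neg hL]
  by_cases hF : r + 6 * k + 3 ≤ 4 * q
  · by_cases hF' : r + 1 + 6 * k + 3 ≤ 4 * q
    · have hm : memB k q r := by unfold memB; omega
      rw [if_pos hF, if_pos hF', if_pos hm, stF_step]
    · have hm : ¬ memB k q r := by unfold memB; omega
      rw [if_pos hF, if_neg hF', if_neg hm, add_zero]
      exact stF_eq_stE k q r _ (by omega) (by omega)
  · rw [if_neg hF, if_neg (by omega)]
    by_cases hm : memB k q r
    · rw [if_pos hm]
      unfold memB at hm
      rw [show min ((r + 1 + 1) / 2) (2 * q + 1) = min ((r + 1) / 2) (2 * q + 1) + 1 by omega,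
        stE_step, show q + 2 * min ((r + 1) / 2) (2 * q + 1) = q + r by omega]
    · rw [if_neg hm, add_zero]
      unfold memB at hm
      congr 1
      omega

lemma st_row (k q : ℕ) : st k (q + 1) 0 = st k q (6 * k + 1) := by
  have hq : q % 3 = 0 ∨ q % 3 = 1 ∨ q % 3 = 2 := by omega
  unfold st
  by_cases hL : 3 * k + 2 ≤ q
  · rw [if_pos hL, if_pos (by omega)]
    unfold stL
    rw [show (q + (6 * k + 1)) % 3 = (q + 1 + 0) % 3 by omega]
  rw [if_neg hL]
  by_cases hL' : 3 * k + 2 ≤ q + 1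
  · have hq : q = 3 * k + 1 := by omega
    rw [if_pos hL', if_pos (by omega)]
    have a : q % 3 = 1 := by omega
    have b : (6 * k + 1) % 3 = 1 := by omega
    simp [stL, stF, a, b, Nat.add_mod]
  rw [if_neg hL', if_neg (c := 6 * k + 1 + 6 * k + 3 ≤ 4 * q) (by omega)]
  by_cases hF : 0 + 6 * k + 3 ≤ 4 * (q + 1)
  · rw [if_pos hF]
    have b : (min ((6 * k + 1 + 1) / 2) (2 * q + 1)) % 3 = 1 := by omega
    rcases hq with hq | hq | hq <;> simp [stE, stF, hq, b, Nat.add_mod]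
  · rw [if_neg hF]
    rw [show min ((6 * k + 1 + 1) / 2) (2 * q + 1) = 2 * q + 1 by omega]
    rcases hq with hq | hq | hq <;> simp [stE, hq, Nat.add_mod, Nat.mul_mod]

lemma st_bound (k q r : ℕ) : |(st k q r).1| ≤ 1 ∧ |(st k q r).2| ≤ 1 ∧
    |(st k q r).1 - (st k q r).2| ≤ 1 := by
  unfold st stL stF stE
  split_ifs <;> simp

lemma cntRes_succ (P : ℕ → Prop) (i x : ℕ) [Decidable (P x ∧ x % 3 = i)] :
    cntRes P i (x + 1) = cntRes P i x + if P x ∧ x % 3 = i then 1 else 0 := by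
  classical
  unfold cntRes
  rw [Nat.count_succ]
  congr

lemma cnt_state (k : ℕ) (hk : 0 < k) (P : ℕ → Prop) (hP : ∀ x, P x ↔
      x ∈ AddSubmonoid.closure ({6 * k + 1, 6 * k + 3, 6 * k + 5} : Set ℕ) ∧ 0 < x) (x : ℕ) :
    ∀ q r, r ≤ 6 * k → x + 1 = q * (6 * k + 1) + r →
      (((cntRes P 0 (x + 1) : ℤ) - cntRes P 1 (x + 1), (cntRes P 0 (x + 1) : ℤ)
        - cntRes P 2 (x + 1)) : ℤ × ℤ) = st k q r := by
  classical
  have key : ∀ x q r, r ≤ 6 * k → x = q * (6 * k + 1) + r → 0 < x →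
      (((cntRes P 0 (x + 1) : ℤ) - cntRes P 1 (x + 1), (cntRes P 0 (x + 1) : ℤ)
        - cntRes P 2 (x + 1)) : ℤ × ℤ) = 
      (((cntRes P 0 x : ℤ) - cntRes P 1 x, (cntRes P 0 x : ℤ)
        - cntRes P 2 x) : ℤ × ℤ) + if memB k q r then inc (q + r) else 0 := by
    intro x q r hr hx hx0
    have hPx : P x ↔ memB k q r := by
      rw [hP, hx, mem_family_iff k q r hr]
      constructor
      · exact fun h => h.1
      · exact fun h => ⟨h, by omega⟩
    have hmod : x % 3 = (q + r) % 3 := by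
      rw [hx, show q * (6 * k + 1) + r = (q + r) + 3 * (2 * (q * k)) by ring,
        Nat.add_mul_mod_self_left]
    simp only [cntRes_succ, hPx, hmod]
    by_cases hm : memB k q r
    · have h3 : (q + r) % 3 = 0 ∨ (q + r) % 3 = 1 ∨ (q + r) % 3 = 2 := by omega
      rcases h3 with h3 | h3 | h3 <;> simp [hm, h3, inc] <;> (try constructor) <;> ring
    · simp [hm]
  induction x with
  | zero =>
    intro q r hr hx
    have hq : q = 0 := by
      by_contra hc
      have : 1 * (6 * k + 1) ≤ q * (6 * k + 1) := Nat.mul_le_mul_right _ (by omega)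
      omega
    subst hq
    obtain rfl : r = 1 := by omega
    have hP0 : ¬ P 0 := by rw [hP]; simp
    have h0 : ∀ i, cntRes P i (0 + 1) = 0 := by
      intro i; rw [cntRes_succ]; simp [hP0, cntRes]
    simp only [h0]
    simp [st, stE]
  | succ x ih =>
    intro q r hr hx
    rcases Nat.eq_zero_or_pos r with rfl | hr0
    · obtain ⟨q, rfl⟩ : ∃ q', q = q' + 1 := by
        refine ⟨q - 1, ?_⟩
        have : q ≠ 0 := by rintro rfl; omega
        omega
      have hx' : x + 1 = q * (6 * k + 1) + 6 * k := by rw [add_mul] at hx; omega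
      rw [key (x + 1) q (6 * k) le_rfl hx' (by omega), ih q (6 * k) le_rfl hx', st_row,
        st_step k q _ le_rfl]
    · obtain ⟨r, rfl⟩ : ∃ r', r = r' + 1 := ⟨r - 1, by omega⟩
      rw [key (x + 1) q r (by omega) (by omega) (by omega), ih q r (by omega) (by omega),
        st_step k q r (by omega)]

lemma cnt_bound (k : ℕ) (hk : 0 < k) (P : ℕ → Prop) (hP : ∀ x, P x ↔
      x ∈ AddSubmonoid.closure ({6 * k + 1, 6 * k + 3, 6 * k + 5} : Set ℕ) ∧ 0 < x) (x : ℕ) :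
    |(cntRes P 0 x : ℤ) - cntRes P 1 x| ≤ 1 ∧ |(cntRes P 0 x : ℤ) - cntRes P 2 x| ≤ 1 ∧
    |(cntRes P 2 x : ℤ) - cntRes P 1 x| ≤ 1 := by
  cases x with
  | zero => simp [cntRes]
  | succ x =>
    have h := cnt_state k hk P hP x ((x + 1) / (6 * k + 1)) ((x + 1) % (6 * k + 1))
      (by have := Nat.mod_lt (x + 1) (show 0 < 6 * k + 1 by omega); omega)
      (by rw [mul_comm]; exact (Nat.div_add_mod _ _).symm)
    have hb := st_bound k ((x + 1) / (6 * k + 1)) ((x + 1) % (6 * k + 1))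
    rw [← h] at hb
    refine ⟨hb.1, hb.2.1, ?_⟩
    have := hb.2.2
    simpa using this

lemma cnt_total (P : ℕ → Prop) [DecidablePred P] (x : ℕ) :
    cntRes P 0 x + cntRes P 1 x + cntRes P 2 x = Nat.count P x := by
  induction x with
  | zero => simp [cntRes]
  | succ x ih =>
    rw [cntRes_succ, cntRes_succ, cntRes_succ, Nat.count_succ, ← ih]
    by_cases hm : P x
    · have h3 : x % 3 = 0 ∨ x % 3 = 1 ∨ x % 3 = 2 := by omega
      rcases h3 with h3 | h3 | h3 <;> simp [hm, h3] <;> ring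
    · simp [hm]

lemma cnt_exists (P : ℕ → Prop) (i x y : ℕ) (h : cntRes P i x < cntRes P i y) :
    ∃ z, x ≤ z ∧ z < y ∧ P z ∧ z % 3 = i := by
  classical
  induction y with
  | zero => simp [cntRes] at h
  | succ y ih =>
    by_cases h' : cntRes P i x < cntRes P i y
    · obtain ⟨z, h1, h2, h3⟩ := ih h'
      exact ⟨z, h1, by omega, h3⟩
    · rw [cntRes_succ] at h
      by_cases hc : P y ∧ y % 3 = i
      · refine ⟨y, ?_, by omega, hc⟩
        by_contra hlt
        have hle : y + 1 ≤ x := by omega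
        have hmono : cntRes P i (y + 1) ≤ cntRes P i x := Nat.count_monotone _ hle
        rw [cntRes_succ] at hmono
        omega
      · rw [if_neg hc] at h
        omega

theorem family4_is_three_permutation (k : ℕ) (hk : 0 < k) :
    IsPermutationSemigroup 3 (AddSubmonoid.closure ({6 * k + 1, 6 * k + 3, 6 * k + 5} : Set ℕ)) := by
  classical
  set G := AddSubmonoid.closure ({6 * k + 1, 6 * k + 3, 6 * k + 5} : Set ℕ) with hG
  set P : ℕ → Prop := fun x => x ∈ G ∧ 0 < x with hPdef
  have hP : ∀ x, P x ↔ x ∈ G ∧ 0 < x := fun x => Iff.rfl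
  have hmem : ∀ q r, r ≤ 6 * k → (q * (6 * k + 1) + r ∈ G ↔ memB k q r) :=
    fun q r hr => mem_family_iff k q r hr
  have hcof : ∀ x, (3 * k + 2) * (6 * k + 1) ≤ x → x ∈ G := by
    intro x hx
    have hr : x % (6 * k + 1) ≤ 6 * k := by
      have := Nat.mod_lt x (show 0 < 6 * k + 1 by omega); omega
    have hq : 3 * k + 2 ≤ x / (6 * k + 1) := (Nat.le_div_iff_mul_le (by omega)).2 hx
    have := (hmem (x / (6 * k + 1)) (x % (6 * k + 1)) hr).2 (by unfold memB; omega)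
    rwa [mul_comm, Nat.div_add_mod] at this
  have hinf : (Set.ofPred P).Infinite := by
    apply Set.infinite_of_not_bddAbove
    rintro ⟨B, hB⟩
    have := hB (show P (B + 1 + (3 * k + 2) * (6 * k + 1)) from ⟨hcof _ (by omega), by omega⟩)
    omega
  have hseq : posSeq G = Nat.nth P := rfl
  have hnthP : ∀ n, P (Nat.nth P n) := fun n => Nat.nth_mem_of_infinite hinf n
  refine ⟨?_, ?_, ?_⟩
  · apply (Set.finite_lt_nat ((3 * k + 2) * (6 * k + 1))).subset
    intro x hx
    by_contra hc
    exact hx (hcof x (by simpa using hc))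
  · apply le_antisymm
    · rw [hG, AddSubmonoid.closure_le]
      have c0 : ∀ x, x ≤ 6 * k + 1 → Nat.count P x = 0 := by
        intro x
        induction x with
        | zero => simp
        | succ x ih =>
          intro hx
          rw [Nat.count_succ, ih (by omega), if_neg]
          rintro ⟨h1, h2⟩
          have := (hmem 0 x (by omega)).1 (by simpa using h1)
          unfold memB at this
          omega
      have m1 : ∀ r, r ≤ 6 * k → (P (6 * k + 1 + r) ↔ memB k 1 r) := by
        intro r hr
        rw [← hmem 1 r hr, one_mul, hP]
        exact and_iff_left (by omega)
      have p0 : P (6 * k + 1) := (m1 0 (by omega)).2 (by unfold memB; omega)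
      have p1 : ¬ P (6 * k + 2) := (m1 1 (by omega)).not.2 (by unfold memB; omega)
      have p2 : P (6 * k + 3) := (m1 2 (by omega)).2 (by unfold memB; omega)
      have p3 : ¬ P (6 * k + 4) := (m1 3 (by omega)).not.2 (by unfold memB; omega)
      have p4 : P (6 * k + 5) := (m1 4 (by omega)).2 (by unfold memB; omega)
      have c1 : Nat.count P (6 * k + 1) = 0 := c0 _ le_rfl
      have c3 : Nat.count P (6 * k + 3) = 1 := by
        rw [Nat.count_succ, Nat.count_succ, if_neg p1, if_pos p0, c1]
      have c5 : Nat.count P (6 * k + 5) = 2 := by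
        rw [Nat.count_succ, Nat.count_succ, if_neg p3, if_pos p2, c3]
      intro y hy
      apply AddSubmonoid.subset_closure
      simp only [Set.mem_insert_iff, Set.mem_singleton_iff] at hy
      rw [hseq]
      rcases hy with rfl | rfl | rfl
      · exact ⟨_, by rw [c1]; simp, Nat.nth_count p0⟩
      · exact ⟨_, by rw [c3]; simp, Nat.nth_count p2⟩
      · exact ⟨_, by rw [c5]; simp, Nat.nth_count p4⟩
    · rw [AddSubmonoid.closure_le]
      rintro _ ⟨n, _, rfl⟩
      exact (hnthP n).1
  · intro b
    rw [hseq]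
    have heq : ∀ b, ∀ i, i < 3 → cntRes P i (Nat.nth P (b * 3)) = b := by
      intro b i hi
      have ht := cnt_total P (Nat.nth P (b * 3))
      rw [Nat.count_nth_of_infinite hinf] at ht
      obtain ⟨h1, h2, h3⟩ := cnt_bound k hk P hP (Nat.nth P (b * 3))
      rw [abs_le] at h1 h2 h3
      interval_cases i <;> omega
    rw [Fintype.bijective_iff_surjective_and_card]
    refine ⟨?_, by simp⟩
    intro c
    have hc : c.val < 3 := ZMod.val_lt c
    obtain ⟨z, h1, h2, h3, h4⟩ := cnt_exists P c.val (Nat.nth P (b * 3)) (Nat.nth P ((b + 1) * 3))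
      (by rw [heq b _ hc, heq (b + 1) _ hc]; omega)
    have l1 := Nat.count_monotone P h1
    rw [Nat.count_nth_of_infinite hinf] at l1
    have l2 : Nat.count P z < (b + 1) * 3 := by
      have : Nat.count P z < Nat.count P (Nat.nth P ((b + 1) * 3)) :=
        Nat.count_strict_mono h3 h2
      rwa [Nat.count_nth_of_infinite hinf] at this
    refine ⟨⟨Nat.count P z - b * 3, by omega⟩, ?_⟩
    simp only
    rw [Nat.add_sub_cancel' l1, Nat.nth_count h3, ← ZMod.natCast_mod, h4, ZMod.natCast_zmod_val]
end

section
/- For every positive integer k, the numerical semigroup generated by S = {12k+2, 12k+4, 18k+3} is a 3-permutation numerical semigroup. -/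
/-- The semigroup generated by `m` and `m+1`, as a predicate. -/
def HH (m x : ℕ) : Prop := ∃ s, s * m ≤ x ∧ x ≤ s * m + s

/-- Membership in the semigroup generated by `2m, 2m+2, 3m`. -/
def GG (m y : ℕ) : Prop := ∃ x, HH m x ∧ (y = 2 * x ∨ y = 3 * m + 2 * x)

theorem HH_add {m x y : ℕ} (hx : HH m x) (hy : HH m y) : HH m (x + y) := by
  obtain ⟨s, h1, h2⟩ := hx
  obtain ⟨t, h3, h4⟩ := hy
  refine ⟨s + t, ?_, ?_⟩ <;> rw [add_mul] <;> omega

theorem HH_zero (m : ℕ) : HH m 0 := ⟨0, by simp, by simp⟩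

theorem HH_three (m : ℕ) : HH m (3 * m) := ⟨3, by omega, by omega⟩

theorem HH_level {m s t : ℕ} (hs : s ≤ m) (ht : t < m) : HH m (s * m + t) ↔ t ≤ s := by
  constructor
  · rintro ⟨s', h1, h2⟩
    rcases lt_trichotomy s' s with h | h | h
    · obtain ⟨d, rfl⟩ : ∃ d, s = s' + 1 + d := ⟨s - s' - 1, by omega⟩
      have : (s' + 1 + d) * m = s' * m + m + d * m := by ring
      have := Nat.zero_le (d * m)
      omega
    · subst h; omega
    · obtain ⟨d, rfl⟩ : ∃ d, s' = s + 1 + d := ⟨s' - s - 1, by omega⟩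
      have : (s + 1 + d) * m = s * m + m + d * m := by ring
      have := Nat.zero_le (d * m)
      omega
  · intro h
    exact ⟨s, by omega, by omega⟩

theorem HH_large {m x : ℕ} (hm : 0 < m) (hx : m * (m - 1) ≤ x) : HH m x := by
  refine ⟨x / m, Nat.div_mul_le_self x m, ?_⟩
  have h1 : m - 1 ≤ x / m := by
    rw [Nat.le_div_iff_mul_le hm, mul_comm]; exact hx
  have h2 := Nat.mod_lt x hm
  have h3 := Nat.div_add_mod' x m
  omega

theorem mem_G_iff (m y : ℕ) :
    y ∈ AddSubmonoid.closure ({2 * m, 2 * m + 2, 3 * m} : Set ℕ) ↔ GG m y := by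
  constructor
  · intro h
    induction h using AddSubmonoid.closure_induction with
    | mem x hx =>
      rcases hx with rfl | rfl | rfl
      · exact ⟨m, ⟨1, by omega, by omega⟩, Or.inl rfl⟩
      · exact ⟨m + 1, ⟨1, by omega, by omega⟩, Or.inl (by ring)⟩
      · exact ⟨0, HH_zero m, Or.inr (by ring)⟩
    | zero => exact ⟨0, HH_zero m, Or.inl rfl⟩
    | add x y _ _ hx hy =>
      obtain ⟨a, ha, ha'⟩ := hx
      obtain ⟨b, hb, hb'⟩ := hy
      rcases ha' with rfl | rfl <;> rcases hb' with rfl | rfl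
      · exact ⟨a + b, HH_add ha hb, Or.inl (by ring)⟩
      · exact ⟨a + b, HH_add ha hb, Or.inr (by ring)⟩
      · exact ⟨a + b, HH_add ha hb, Or.inr (by ring)⟩
      · exact ⟨3 * m + (a + b), HH_add (HH_three m) (HH_add ha hb), Or.inl (by ring)⟩
  · have key : ∀ x, HH m x →
        2 * x ∈ AddSubmonoid.closure ({2 * m, 2 * m + 2, 3 * m} : Set ℕ) := by
      rintro x ⟨s, h1, h2⟩
      obtain ⟨t, rfl⟩ := Nat.exists_eq_add_of_le h1
      obtain ⟨u, rfl⟩ : ∃ u, s = t + u := ⟨s - t, by omega⟩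
      have : 2 * ((t + u) * m + t) = u • (2 * m) + t • (2 * m + 2) := by
        simp only [smul_eq_mul]; ring
      rw [this]
      exact add_mem (AddSubmonoid.nsmul_mem _ (AddSubmonoid.subset_closure (by simp)) _)
        (AddSubmonoid.nsmul_mem _ (AddSubmonoid.subset_closure (by simp)) _)
    rintro ⟨x, hx, rfl | rfl⟩
    · exact key x hx
    · exact add_mem (AddSubmonoid.subset_closure (by simp)) (key x hx)

theorem GG_even {m k : ℕ} (hm : m = 6 * k + 1) (x : ℕ) : GG m (2 * x) ↔ HH m x := by
  constructor
  · rintro ⟨y, hy, h | h⟩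
    · obtain rfl : x = y := by omega
      exact hy
    · omega
  · intro h; exact ⟨x, h, Or.inl rfl⟩

theorem GG_odd {m k : ℕ} (hm : m = 6 * k + 1) (x : ℕ) : GG m (3 * m + 2 * x) ↔ HH m x := by
  constructor
  · rintro ⟨y, hy, h | h⟩
    · omega
    · obtain rfl : x = y := by omega
      exact hy
  · intro h; exact ⟨x, h, Or.inr rfl⟩

theorem GG_odd_small {m k : ℕ} (hm : m = 6 * k + 1) (y : ℕ) (h1 : y % 2 = 1) (h2 : y < 3 * m) :
    ¬ GG m y := by
  rintro ⟨x, hx, h | h⟩ <;> omega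

theorem GG_large {m k y : ℕ} (hm : m = 6 * k + 1) (hy : 2 * (m * m) + m ≤ y) : GG m y := by
  have hmm : m * (m - 1) + m = m * m := by
    subst hm; simp; ring
  rcases Nat.even_or_odd' y with ⟨x, rfl | rfl⟩
  · rw [GG_even hm]; exact HH_large (by omega) (by omega)
  · obtain ⟨z, hz⟩ : ∃ z, 2 * x + 1 = 3 * m + 2 * z := ⟨x - 9 * k - 1, by omega⟩
    rw [hz, GG_odd hm]; exact HH_large (by omega) (by omega)

open Classical in
/-- Counting elements of `HH` by residue of `2x`. -/
noncomputable def hc (m r M : ℕ) : ℕ := Nat.count (fun x => HH m x ∧ (2 * x) % 3 = r) M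

open Classical in
/-- Counting positive elements of `GG` by residue. -/
noncomputable def gc (m r N : ℕ) : ℕ := Nat.count (fun x => (GG m x ∧ 0 < x) ∧ x % 3 = r) N

open Classical in
theorem hc_succ (m r M : ℕ) :
    hc m r (M + 1) = hc m r M + if HH m M ∧ (2 * M) % 3 = r then 1 else 0 := by
  unfold hc; rw [Nat.count_succ]

open Classical in
theorem gc_succ (m r N : ℕ) :
    gc m r (N + 1) = gc m r N + if (GG m N ∧ 0 < N) ∧ N % 3 = r then 1 else 0 := by
  unfold gc; rw [Nat.count_succ]

theorem hc_zero (m r : ℕ) : hc m r 0 = 0 := by simp [hc]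
theorem gc_zero (m r : ℕ) : gc m r 0 = 0 := by simp [gc]

theorem gc_eq {m k : ℕ} (hm : m = 6 * k + 1) (r N : ℕ) :
    gc m r N + (if r = 0 ∧ 0 < N then 1 else 0)
      = hc m r ((N + 1) / 2) + hc m r ((N + 1 - 3 * m) / 2) := by
  classical
  induction N with
  | zero =>
    have : (0 + 1 - 3 * m) / 2 = 0 := by omega
    rw [this]; simp [gc_zero, hc_zero]
  | succ N ih =>
    rw [gc_succ]
    rcases Nat.even_or_odd' N with ⟨x, hx | hx⟩
    · have e1 : (N + 1 + 1) / 2 = x + 1 := by omega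
      have e2 : (N + 1) / 2 = x := by omega
      have e3 : (N + 1 + 1 - 3 * m) / 2 = (N + 1 - 3 * m) / 2 := by omega
      rw [e1, e3, hc_succ]
      rw [e2] at ih
      have hG : GG m N ↔ HH m x := by rw [hx]; exact GG_even hm x
      have hx3 : (2 * x) % 3 = N % 3 := by rw [hx]
      simp only [hG, hx3]
      by_cases hN : N = 0
      · obtain rfl : x = 0 := by omega
        subst hN
        have := HH_zero m
        simp [this, eq_comm] at ih ⊢
        split_ifs <;> omega
      · have hN' : 0 < N := by omega
        simp only [hN', and_true, Nat.succ_pos] at ih ⊢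
        omega
    · have e1 : (N + 1 + 1) / 2 = (N + 1) / 2 := by omega
      have hN' : 0 < N := by omega
      rw [e1]
      simp only [hN', and_true, Nat.succ_pos] at ih ⊢
      by_cases h : N < 3 * m
      · have e2 : (N + 1 + 1 - 3 * m) / 2 = (N + 1 - 3 * m) / 2 := by omega
        have := GG_odd_small hm N (by omega) h
        rw [e2, ← ih]
        simp [this]
      · obtain ⟨z, hz⟩ : ∃ z, N = 3 * m + 2 * z := ⟨x - 9 * k - 1, by omega⟩
        have e2 : (N + 1 + 1 - 3 * m) / 2 = z + 1 := by omega
        have e3 : (N + 1 - 3 * m) / 2 = z := by omega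
        have hG : GG m N ↔ HH m z := by rw [hz]; exact GG_odd hm z
        have hx3 : (2 * z) % 3 = N % 3 := by omega
        rw [e2, hc_succ]
        rw [e3] at ih
        simp only [hG, hx3]
        omega

/-- The balance state: which residues are in excess. -/
def Tab (a b h0 h1 h2 : ℕ) : Prop :=
  (a = 0 ∧ b = 0 ∧ h0 = h1 ∧ h1 = h2) ∨
  (a = 0 ∧ b = 1 ∧ h0 = h1 + 1 ∧ h1 = h2) ∨
  (a = 0 ∧ b = 2 ∧ h0 = h1 + 1 ∧ h2 = h1 + 1) ∨
  (a = 1 ∧ b = 0 ∧ h0 = h1 + 1 ∧ h1 = h2) ∨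
  (a = 1 ∧ b = 1 ∧ h0 = h1 + 1 ∧ h2 = h1 + 1) ∨
  (a = 1 ∧ b = 2 ∧ h0 = h1 ∧ h1 = h2) ∨
  (a = 2 ∧ b = 0 ∧ h0 = h1 ∧ h1 = h2) ∨
  (a = 2 ∧ b = 1 ∧ h1 = h0 + 1 ∧ h2 = h0) ∨
  (a = 2 ∧ b = 2 ∧ h0 = h2 + 1 ∧ h1 = h2 + 1)

theorem tab_level_step {m k : ℕ} (hm : m = 6 * k + 1) (s : ℕ) (hs : s ≤ m)
    (h0 : Tab (s % 3) 0 (hc m 0 (s * m)) (hc m 1 (s * m)) (hc m 2 (s * m))) (t : ℕ) (ht : t ≤ m) :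
    Tab (s % 3) (min t (s + 1) % 3) (hc m 0 (s * m + t)) (hc m 1 (s * m + t))
      (hc m 2 (s * m + t)) := by
  classical
  induction t with
  | zero => simpa using h0
  | succ t ih =>
    have ih := ih (by omega)
    have hl := HH_level hs (show t < m by omega)
    rw [← add_assoc, hc_succ, hc_succ, hc_succ]
    simp only [hl]
    by_cases h : t ≤ s
    · have e1 : min (t + 1) (s + 1) = t + 1 := by omega
      have e2 : min t (s + 1) = t := by omega
      have e3 : (2 * (s * m + t)) % 3 = (2 * (s % 3) + 2 * (t % 3)) % 3 := by
        have : 2 * (s * m + t) = 2 * s + 2 * t + 3 * (4 * s * k) := by rw [hm]; ring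
        omega
      rw [e1]
      rw [e2] at ih
      have e4 : (t + 1) % 3 = (t % 3 + 1) % 3 := by omega
      rw [e3, e4]
      simp only [h, true_and]
      have ha : s % 3 < 3 := Nat.mod_lt _ (by omega)
      have hb : t % 3 < 3 := Nat.mod_lt _ (by omega)
      generalize s % 3 = a at *
      generalize t % 3 = b at *
      unfold Tab at *
      interval_cases a <;> interval_cases b <;> simp at ih ⊢ <;> omega
    · have e1 : min (t + 1) (s + 1) = min t (s + 1) := by omega
      rw [e1]
      simpa [h] using ih

theorem tab_start {m k : ℕ} (hm : m = 6 * k + 1) (s : ℕ) (hs : s ≤ m) :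
    Tab (s % 3) 0 (hc m 0 (s * m)) (hc m 1 (s * m)) (hc m 2 (s * m)) := by
  induction s with
  | zero => simp [Tab, hc_zero]
  | succ s ih =>
    have h := tab_level_step hm s (by omega) (ih (by omega)) m le_rfl
    have e : min m (s + 1) = s + 1 := by omega
    rw [e] at h
    have e2 : (s + 1) * m = s * m + m := by ring
    rw [e2]
    have e3 : (s + 1) % 3 = (s % 3 + 1) % 3 := by omega
    rw [e3] at h ⊢
    have ha : s % 3 < 3 := Nat.mod_lt _ (by omega)
    generalize s % 3 = a at *
    unfold Tab at h ⊢
    clear ih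
    interval_cases a <;> simp at h ⊢ <;> omega

theorem tab_all {m k : ℕ} (hm : m = 6 * k + 1) (s t : ℕ) (hs : s ≤ m) (ht : t ≤ m) :
    Tab (s % 3) (min t (s + 1) % 3) (hc m 0 (s * m + t)) (hc m 1 (s * m + t))
      (hc m 2 (s * m + t)) :=
  tab_level_step hm s hs (tab_start hm s hs) t ht

/-- All three counts differ by at most one. -/
def Bal (a b c : ℕ) : Prop :=
  a ≤ b + 1 ∧ a ≤ c + 1 ∧ b ≤ a + 1 ∧ b ≤ c + 1 ∧ c ≤ a + 1 ∧ c ≤ b + 1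

theorem tab_comb1 {a b b' d x0 x1 x2 y0 y1 y2 g0 : ℕ} (ha : a < 3) (hb : b < 3) (hb' : b' < 3)
    (hd : d ≤ 1) (T' : Tab a b' x0 x1 x2) (T : Tab ((a + 1) % 3) b y0 y1 y2)
    (h : b' = (b + 2 * d) % 3 ∨ b = (a + 2) % 3) (hg : g0 + 1 = y0 + x0) :
    Bal g0 (y1 + x1) (y2 + x2) := by
  unfold Tab at T T'
  unfold Bal
  interval_cases d <;> interval_cases a <;> interval_cases b <;> interval_cases b' <;>
    simp at h T T' ⊢ <;> omega

theorem tab_comb2 {a b b' d x0 x1 x2 y0 y1 y2 g0 : ℕ} (ha : a < 3) (hb : b < 3) (hb' : b' < 3)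
    (hd : d ≤ 1) (T' : Tab a b' x0 x1 x2) (T : Tab ((a + 2) % 3) b y0 y1 y2)
    (h : b' = (b + 1 + 2 * d) % 3 ∨ b' = (a + 1) % 3) (hg : g0 + 1 = y0 + x0) :
    Bal g0 (y1 + x1) (y2 + x2) := by
  unfold Tab at T T'
  unfold Bal
  interval_cases d <;> interval_cases a <;> interval_cases b <;> interval_cases b' <;>
    simp at h T T' ⊢ <;> omega

theorem bal_small {m k : ℕ} (hm : m = 6 * k + 1) (N : ℕ) (hN : N ≤ 2 * (m * m) + 2 * m) :
    Bal (gc m 0 N) (gc m 1 N) (gc m 2 N) := by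
  rcases Nat.eq_zero_or_pos N with rfl | hpos
  · simp [Bal, gc_zero]
  have g0 := gc_eq hm 0 N
  have g1 := gc_eq hm 1 N
  have g2 := gc_eq hm 2 N
  simp only [hpos, and_true, if_true] at g0 g1 g2
  norm_num at g1 g2
  obtain ⟨s, t, hs, ht, hM, htt⟩ : ∃ s t, s ≤ m ∧ t ≤ m ∧ (N + 1) / 2 = s * m + t ∧
      (t < m ∨ s = m) := by
    by_cases h : (N + 1) / 2 < m * m
    · refine ⟨(N + 1) / 2 / m, (N + 1) / 2 % m, ?_, ?_, ?_, ?_⟩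
      · exact (Nat.div_lt_of_lt_mul h).le
      · exact (Nat.mod_lt _ (by omega)).le
      · exact (Nat.div_add_mod' _ _).symm
      · exact Or.inl (Nat.mod_lt _ (by omega))
    · exact ⟨m, (N + 1) / 2 - m * m, le_rfl, by omega, by omega, Or.inr rfl⟩
  have T := tab_all hm s t hs ht
  rw [← hM] at T
  obtain ⟨d, hd, hM'⟩ : ∃ d, d ≤ 1 ∧ (N + 1 - 3 * m) / 2 = s * m + t - (m + 3 * k + d) :=
    ⟨N % 2, by omega, by omega⟩
  rw [hM'] at g0 g1 g2
  by_cases hsmall : s * m + t ≤ m + 3 * k + d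
  · have e : s * m + t - (m + 3 * k + d) = 0 := by omega
    rw [e] at g0 g1 g2
    simp only [hc_zero] at g0 g1 g2
    have hs1 : s ≤ 1 := by
      by_contra hcon
      have : 2 * m ≤ s * m := Nat.mul_le_mul_right m (by omega)
      omega
    unfold Tab at T; unfold Bal
    interval_cases s <;> omega
  · by_cases hc1 : 3 * k + d ≤ t
    · obtain ⟨s', rfl⟩ : ∃ s', s = s' + 1 := by
        refine ⟨s - 1, ?_⟩
        rcases Nat.eq_zero_or_pos s with h | h
        · subst h; omega
        · omega
      have T' := tab_all hm s' (t - (3 * k + d)) (by omega) (by omega)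
      have e : (s' + 1) * m + t - (m + 3 * k + d) = s' * m + (t - (3 * k + d)) := by
        have : (s' + 1) * m = s' * m + m := by ring
        omega
      rw [e] at g0 g1 g2
      have key : min (t - (3 * k + d)) (s' + 1) % 3 = (min t (s' + 1 + 1) % 3 + 2 * d) % 3
          ∨ min t (s' + 1 + 1) % 3 = (s' % 3 + 2) % 3 := by
        by_cases hle : t ≤ s' + 2
        · left
          rw [min_eq_left (by omega), min_eq_left (by omega)]
          omega
        · right
          rw [min_eq_right (by omega)]
          omega
      rw [Nat.add_mod s' 1 3] at T
      rw [g1, g2]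
      exact tab_comb1 (Nat.mod_lt _ (by omega)) (Nat.mod_lt _ (by omega))
        (Nat.mod_lt _ (by omega)) hd T' T key g0
    · obtain ⟨s', rfl⟩ : ∃ s', s = s' + 2 := by
        refine ⟨s - 2, ?_⟩
        by_contra hcon
        have : s ≤ 1 := by omega
        interval_cases s <;> omega
      have T' := tab_all hm s' (t + 3 * k + 1 - d) (by omega) (by omega)
      have e : (s' + 2) * m + t - (m + 3 * k + d) = s' * m + (t + 3 * k + 1 - d) := by
        have : (s' + 2) * m = s' * m + 2 * m := by ring
        omega
      rw [e] at g0 g1 g2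
      have key : min (t + 3 * k + 1 - d) (s' + 1) % 3 = (min t (s' + 2 + 1) % 3 + 1 + 2 * d) % 3
          ∨ min (t + 3 * k + 1 - d) (s' + 1) % 3 = (s' % 3 + 1) % 3 := by
        by_cases hle : t + 3 * k + 1 - d ≤ s' + 1
        · left
          rw [min_eq_left (by omega), min_eq_left (by omega)]
          omega
        · right
          rw [min_eq_right (by omega)]
          omega
      rw [Nat.add_mod s' 2 3] at T
      rw [g1, g2]
      exact tab_comb2 (Nat.mod_lt _ (by omega)) (Nat.mod_lt _ (by omega))
        (Nat.mod_lt _ (by omega)) hd T' T key g0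

theorem bal_all {m k : ℕ} (hk : 0 < k) (hm : m = 6 * k + 1) (N : ℕ) :
    Bal (gc m 0 N) (gc m 1 N) (gc m 2 N) := by
  classical
  induction N using Nat.strong_induction_on with
  | _ N ih =>
    by_cases h : N ≤ 2 * (m * m) + 2 * m
    · exact bal_small hm N h
    · obtain ⟨n, rfl⟩ : ∃ n, N = n + 3 := ⟨N - 3, by omega⟩
      have := ih n (by omega)
      have h0 := GG_large hm (show 2 * (m * m) + m ≤ n by omega)
      have h1 := GG_large hm (show 2 * (m * m) + m ≤ n + 1 by omega)
      have h2 := GG_large hm (show 2 * (m * m) + m ≤ n + 2 by omega)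
      have key : ∀ r, r < 3 → gc m r (n + 3) = gc m r n + 1 := by
        intro r hr
        rw [show n + 3 = n + 1 + 1 + 1 from rfl, gc_succ, gc_succ, gc_succ]
        simp only [h0, h1, h2, true_and, show 0 < n by omega, show 0 < n + 1 by omega,
          show 0 < n + 1 + 1 by omega]
        split_ifs <;> omega
      rw [key 0 (by omega), key 1 (by omega), key 2 (by omega)]
      unfold Bal at *
      omega

open Classical in
theorem gc_sum (m N : ℕ) :
    Nat.count (fun x => GG m x ∧ 0 < x) N = gc m 0 N + gc m 1 N + gc m 2 N := by
  induction N with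
  | zero => simp [gc_zero]
  | succ N ih =>
    rw [Nat.count_succ, gc_succ, gc_succ, gc_succ, ih]
    by_cases h : GG m N ∧ 0 < N
    · simp only [h, true_and, if_true, and_self]
      have : N % 3 < 3 := Nat.mod_lt _ (by omega)
      split_ifs <;> omega
    · simp [h]

theorem gc_mono (m r : ℕ) {a b : ℕ} (h : a ≤ b) : gc m r a ≤ gc m r b := by
  classical
  exact Nat.count_monotone _ h

theorem inj_aux {m k : ℕ} (hk : 0 < k) (hm : m = 6 * k + 1)
    (hinf : (setOf (fun x => GG m x ∧ 0 < x)).Infinite) (K i j : ℕ) (hij : i < j) (hj : j < 3)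
    (h : Nat.nth (fun x => GG m x ∧ 0 < x) (K * 3 + i) % 3
      = Nat.nth (fun x => GG m x ∧ 0 < x) (K * 3 + j) % 3) : False := by
  classical
  set p : ℕ → Prop := fun x => GG m x ∧ 0 < x with hp
  have hmono : StrictMono (Nat.nth p) := Nat.nth_strictMono hinf
  have cA := Nat.count_nth_of_infinite hinf (K * 3)
  have cB := Nat.count_nth_of_infinite hinf (K * 3 + 3)
  rw [gc_sum] at cA cB
  have bA := bal_all hk hm (Nat.nth p (K * 3))
  have bB := bal_all hk hm (Nat.nth p (K * 3 + 3))
  have l1 : Nat.nth p (K * 3) ≤ Nat.nth p (K * 3 + i) := hmono.monotone (by omega)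
  have l2 : Nat.nth p (K * 3 + i) + 1 ≤ Nat.nth p (K * 3 + j) := hmono (by omega)
  have l3 : Nat.nth p (K * 3 + j) + 1 ≤ Nat.nth p (K * 3 + 3) := hmono (by omega)
  have pi : p (Nat.nth p (K * 3 + i)) := Nat.nth_mem_of_infinite hinf _
  have pj : p (Nat.nth p (K * 3 + j)) := Nat.nth_mem_of_infinite hinf _
  have hr : Nat.nth p (K * 3 + j) % 3 < 3 := Nat.mod_lt _ (by omega)
  generalize hrr : Nat.nth p (K * 3 + j) % 3 = r at *
  have s1 := gc_succ m r (Nat.nth p (K * 3 + i))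
  have s2 := gc_succ m r (Nat.nth p (K * 3 + j))
  rw [if_pos ⟨pi, h⟩] at s1
  rw [if_pos ⟨pj, hrr⟩] at s2
  have m1 := gc_mono m r l1
  have m2 := gc_mono m r l2
  have m3 := gc_mono m r l3
  unfold Bal at bA bB
  interval_cases r <;> omega

theorem family8_is_three_permutation (k : ℕ) (hk : 0 < k) :
    IsPermutationSemigroup 3 (AddSubmonoid.closure ({12 * k + 2, 12 * k + 4, 18 * k + 3} : Set ℕ)) := by
  classical
  obtain ⟨m, hm⟩ : ∃ m, m = 6 * k + 1 := ⟨_, rfl⟩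
  rw [show 12 * k + 2 = 2 * m by omega, show 12 * k + 4 = 2 * m + 2 by omega,
    show 18 * k + 3 = 3 * m by omega]
  have hpred : (fun x => x ∈ AddSubmonoid.closure ({2 * m, 2 * m + 2, 3 * m} : Set ℕ) ∧ 0 < x)
      = fun x => GG m x ∧ 0 < x := by
    funext x; rw [mem_G_iff]
  have hinf : (setOf (fun x => GG m x ∧ 0 < x)).Infinite := by
    apply Set.infinite_of_not_bddAbove
    rintro ⟨B, hB⟩
    have := hB (show 2 * (m * m) + m + B + 1 ∈ setOf (fun x => GG m x ∧ 0 < x) from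
      ⟨GG_large hm (by omega), by omega⟩)
    omega
  unfold IsPermutationSemigroup posSeq
  rw [hpred]
  refine ⟨?_, ?_, ?_⟩
  · apply (Set.finite_lt_nat (2 * (m * m) + m)).subset
    intro x hx
    by_contra hcon
    apply hx
    simp only [Set.mem_setOf_eq, not_lt] at hcon
    exact (mem_G_iff m x).2 (GG_large hm hcon)
  · apply le_antisymm
    · have hcount : Nat.count (fun x => GG m x ∧ 0 < x) (3 * m) ≤ 2 := by
        rw [Nat.count_eq_card_filter_range]
        refine (Finset.card_le_card (t := {2 * m, 2 * m + 2}) ?_).trans Finset.card_le_two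
        intro x hx
        simp only [Finset.mem_filter, Finset.mem_range, Finset.mem_insert,
          Finset.mem_singleton] at hx ⊢
        obtain ⟨hx1, ⟨y, ⟨s, hs1, hs2⟩, hy⟩, hx0⟩ := hx
        have hs : s < 2 := by
          by_contra hcon
          have : 2 * m ≤ s * m := Nat.mul_le_mul_right m (by omega)
          omega
        interval_cases s <;> omega
      have gen : ∀ x, x ≤ 3 * m → GG m x → 0 < x →
          x ∈ Nat.nth (fun x => GG m x ∧ 0 < x) '' Set.Iio 3 := by
        intro x hx hG h0
        refine ⟨Nat.count (fun x => GG m x ∧ 0 < x) x, ?_, Nat.nth_count (p := fun x => GG m x ∧ 0 < x) ⟨hG, h0⟩⟩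
        have := Nat.count_monotone (fun x => GG m x ∧ 0 < x) hx
        simp only [Set.mem_Iio]
        omega
      apply AddSubmonoid.closure_mono
      intro x hx
      have hG := (mem_G_iff m x).1 (AddSubmonoid.subset_closure hx)
      have : x ≤ 3 * m ∧ 0 < x := by
        rcases hx with rfl | rfl | rfl <;> omega
      exact gen x this.1 hG this.2
    · rw [AddSubmonoid.closure_le]
      rintro _ ⟨n, _, rfl⟩
      exact (mem_G_iff m _).2 (Nat.nth_mem_of_infinite hinf n).1
  · intro K
    rw [Fintype.bijective_iff_injective_and_card]
    refine ⟨?_, by simp [ZMod.card]⟩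
    intro i j hij
    simp only [ZMod.natCast_eq_natCast_iff'] at hij
    rcases lt_trichotomy i j with h | h | h
    · exact (inj_aux hk hm hinf K i j h j.2 hij).elim
    · exact h
    · exact (inj_aux hk hm hinf K j i h i.2 hij.symm).elim
end
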